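/- Let m ∈ ℕ, let R : ℝ^m → ℝ be convex, let T > 0, let f : ℝ → ℝ^m be any function, and let u, v : ℝ → ℝ^m be Lipschitz continuous with u(0) = v(0). Suppose that for almost every t ∈ (0,T) there exist d_u, d_v ∈ ℝ^m such that u is differentiable at t with derivative d_u, v is differentiable at t with derivative d_v, and f(t) − u(t) ∈ ∂R(d_u) and f(t) − v(t) ∈ ∂R(d_v), where z ∈ ∂R(a) means R(ξ) ≥ R(a) + ⟨z, ξ − a⟩ for all ξ ∈ ℝ^m. Then u(t) = v(t) for all t ∈ [0,T]. -/

import Mathlib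

open MeasureTheory
open scoped InnerProductSpace

/-- An absolutely continuous function with a.e. nonpositive derivative does not increase. -/
theorem AbsolutelyContinuousOnInterval.le_of_ae_deriv_nonpos {φ : ℝ → ℝ} {a b : ℝ} (hab : a ≤ b)
    (hφ : AbsolutelyContinuousOnInterval φ a b)
    (hd : ∀ᵐ t ∂(volume.restrict (Set.Ioo a b)), deriv φ t ≤ 0) : φ b ≤ φ a := by
  have hint : ∫ t in a..b, deriv φ t ≤ 0 := by
    rw [intervalIntegral.integral_of_le hab, integral_Ioc_eq_integral_Ioo]
    exact integral_nonpos_of_ae hd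
  have := hφ.integral_deriv_eq_sub
  linarith

/-- Subdifferentials are monotone. -/
theorem inner_sub_sub_nonneg_of_subgradient {E : Type*} [NormedAddCommGroup E]
    [InnerProductSpace ℝ E] {R : E → ℝ} {a b p q : E}
    (hp : ∀ ξ, R ξ ≥ R a + ⟪p, ξ - a⟫_ℝ) (hq : ∀ ξ, R ξ ≥ R b + ⟪q, ξ - b⟫_ℝ) :
    0 ≤ ⟪p - q, a - b⟫_ℝ := by
  have h1 := hp b
  have h2 := hq a
  rw [← neg_sub a b, inner_neg_right] at h1
  rw [inner_sub_left]
  linarith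

/-- Zero-dimensional uniqueness mechanism. If `R : ℝ^m → ℝ` is convex and
`u, v` are Lipschitz curves with `u(0) = v(0)` that both solve the rate-independent
system `f(t) − u(t) ∈ ∂R(u̇(t))` for a.e. `t ∈ (0,T)`, then `u = v` on `[0,T]`. -/
theorem zeroDim_uniqueness (m : ℕ) (R : EuclideanSpace ℝ (Fin m) → ℝ)
    (hconv : ConvexOn ℝ Set.univ R) (T : ℝ) (hT : 0 < T)
    (f : ℝ → EuclideanSpace ℝ (Fin m))
    (u v : ℝ → EuclideanSpace ℝ (Fin m))
    (hu : ∃ K : NNReal, LipschitzWith K u) (hv : ∃ K : NNReal, LipschitzWith K v)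
    (h0 : u 0 = v 0)
    (hsol : ∀ᵐ t ∂(volume.restrict (Set.Ioo (0:ℝ) T)),
      ∃ du dv : EuclideanSpace ℝ (Fin m),
        HasDerivAt u du t ∧ HasDerivAt v dv t ∧
        (∀ ξ, R ξ ≥ R du + ⟪f t - u t, ξ - du⟫_ℝ) ∧
        (∀ ξ, R ξ ≥ R dv + ⟪f t - v t, ξ - dv⟫_ℝ)) :
    ∀ t ∈ Set.Icc (0:ℝ) T, u t = v t := by
  obtain ⟨K, hK⟩ := hu
  obtain ⟨L, hL⟩ := hv
  rintro t ⟨ht0, htT⟩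
  have hnorm : AbsolutelyContinuousOnInterval (fun s ↦ ‖u s - v s‖) 0 t :=
    (lipschitzWith_one_norm.comp (hK.sub hL)).lipschitzOnWith.absolutelyContinuousOnInterval
  have hsq : AbsolutelyContinuousOnInterval (fun s ↦ ‖u s - v s‖ ^ 2) 0 t := by
    simpa only [sq] using hnorm.fun_mul hnorm
  have hle : ‖u t - v t‖ ^ 2 ≤ ‖u 0 - v 0‖ ^ 2 := by
    refine hsq.le_of_ae_deriv_nonpos ht0 ?_
    filter_upwards [ae_restrict_of_ae_restrict_of_subset (Set.Ioo_subset_Ioo_right htT) hsol]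
    rintro s ⟨du, dv, hdu, hdv, hRu, hRv⟩
    have hmono := inner_sub_sub_nonneg_of_subgradient hRu hRv
    rw [sub_sub_sub_cancel_left, ← neg_sub (u s) (v s), inner_neg_left] at hmono
    have hderiv : deriv (fun r ↦ ‖u r - v r‖ ^ 2) s = 2 * ⟪u s - v s, du - dv⟫_ℝ :=
      (hdu.sub hdv).norm_sq.deriv
    linarith
  rw [h0, sub_self, norm_zero] at hle
  exact sub_eq_zero.mp (norm_eq_zero.mp (by nlinarith [norm_nonneg (u t - v t)]))
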